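/- Consider a Markov chain choice model without the 'no purchase' option, and let r ≥ 2. Suppose the assortments S_1, S_2, …, S_T ⊆ N each have cardinality r and have a pairwise common intersection S_∩ = S_t ∩ S_{t′} for all t ≠ t′ with |S_∩| = r − 1. Then dim(Span ⋃_{t=1}^T { h_{j,S_t} : j ∈ S_t }) ≥ T + r − 1. -/

import Mathlib

open Matrix Filter Finset

/-- The product-by-product submatrix `ρ̃` of the transition matrix
(rows/columns indexed by the products `1,…,n`, i.e. the nonzero states). -/
def subRho {n : ℕ} (rho : Matrix (Fin (n+1)) (Fin (n+1)) ℝ) : Matrix (Fin n) (Fin n) ℝ :=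
  Matrix.of fun i j => rho i.succ j.succ

/-- Markov chain choice model: `lam` is a probability vector on the states `{0,1,…,n}`,
`rho` is row-stochastic, state `0` (no purchase) is absorbing, there are no self-loops on
product states, and the product-by-product submatrix `ρ̃` is irreducible. -/
def IsMCCM {n : ℕ} (lam : Fin (n+1) → ℝ) (rho : Matrix (Fin (n+1)) (Fin (n+1)) ℝ) : Prop :=
  (∀ i, 0 ≤ lam i) ∧ (∑ i, lam i = 1) ∧
  (∀ i j, 0 ≤ rho i j) ∧ (∀ i, ∑ j, rho i j = 1) ∧
  rho 0 0 = 1 ∧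
  (∀ i : Fin (n+1), i ≠ 0 → rho i i = 0) ∧
  (∀ i j : Fin n, ∃ t : ℕ, 1 ≤ t ∧ 0 < (subRho rho ^ t) i j)

/-- `ρ^S`: the transition matrix with every row `i ∈ S` replaced by the `i`-th standard
basis vector, so that all states of `S ∪ {0}` are absorbing. -/
def absorb {n : ℕ} (rho : Matrix (Fin (n+1)) (Fin (n+1)) ℝ) (S : Finset (Fin (n+1))) :
    Matrix (Fin (n+1)) (Fin (n+1)) ℝ :=
  Matrix.of fun i j => if i ∈ S then (if j = i then (1 : ℝ) else 0) else rho i j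

/-- The conditional choice probability `π(j, S ∣ i) := lim_{t→∞} ((ρ^S)^t)_{i,j}`. -/
noncomputable def condProb {n : ℕ} (rho : Matrix (Fin (n+1)) (Fin (n+1)) ℝ)
    (S : Finset (Fin (n+1))) (i j : Fin (n+1)) : ℝ :=
  limUnder atTop fun t : ℕ => (absorb rho S ^ t) i j

/-- The choice probability `π(j, S) := ∑_{k ∈ N₊} λ_k · π(j, S ∣ k)`. -/
noncomputable def choiceProb {n : ℕ} (lam : Fin (n+1) → ℝ)
    (rho : Matrix (Fin (n+1)) (Fin (n+1)) ℝ) (S : Finset (Fin (n+1))) (j : Fin (n+1)) : ℝ :=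
  ∑ k, lam k * condProb rho S k j

/-- The vector `h_{j,S} = (π(j, S ∣ k))_{k ∈ N} ∈ ℝ^n` (no "no purchase" option). -/
noncomputable def hvecN {n : ℕ} (rho : Matrix (Fin (n+1)) (Fin (n+1)) ℝ)
    (S : Finset (Fin (n+1))) (j : Fin (n+1)) : Fin n → ℝ :=
  fun k => condProb rho S k.succ j

section AbsorbingChain

variable {n : ℕ} {rho : Matrix (Fin (n+1)) (Fin (n+1)) ℝ} {S : Finset (Fin (n+1))}

theorem absorb_mem_rowStochastic (hrho : rho ∈ rowStochastic ℝ (Fin (n+1)))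
    (S : Finset (Fin (n+1))) : absorb rho S ∈ rowStochastic ℝ (Fin (n+1)) := by
  rw [mem_rowStochastic_iff_sum] at hrho ⊢
  refine ⟨fun i j => ?_, fun i => ?_⟩
  · simp only [absorb, of_apply]
    split_ifs
    exacts [zero_le_one, le_rfl, hrho.1 i j]
  · by_cases hi : i ∈ S
    · simp [absorb, hi]
    · simp [absorb, hi, hrho.2 i]

/-- The probabilities of having been absorbed in `j ∈ S` increase to `π(j, S ∣ i)`. -/
theorem tendsto_condProb (hrho : rho ∈ rowStochastic ℝ (Fin (n+1))) {j : Fin (n+1)}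
    (hj : j ∈ S) (i : Fin (n+1)) :
    Tendsto (fun t : ℕ => (absorb rho S ^ t) i j) atTop (nhds (condProb rho S i j)) := by
  have hA := absorb_mem_rowStochastic hrho S
  have hmono : Monotone fun t : ℕ => (absorb rho S ^ t) i j := by
    refine monotone_nat_of_le_succ fun t => ?_
    rw [pow_succ, Matrix.mul_apply]
    calc (absorb rho S ^ t) i j = (absorb rho S ^ t) i j * absorb rho S j j := by
          simp [absorb, hj]
      _ ≤ ∑ k, (absorb rho S ^ t) i k * absorb rho S k j :=
          single_le_sum (f := fun k => (absorb rho S ^ t) i k * absorb rho S k j)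
            (fun k _ => mul_nonneg (nonneg_of_mem_rowStochastic (pow_mem hA t))
              (nonneg_of_mem_rowStochastic hA)) (mem_univ j)
  have hbdd : BddAbove (Set.range fun t : ℕ => (absorb rho S ^ t) i j) := by
    refine ⟨1, ?_⟩
    rintro _ ⟨t, rfl⟩
    exact le_one_of_mem_rowStochastic (pow_mem hA t)
  exact tendsto_nhds_limUnder ⟨_, tendsto_atTop_ciSup hmono hbdd⟩

theorem condProb_le_one (hrho : rho ∈ rowStochastic ℝ (Fin (n+1))) {j : Fin (n+1)}
    (hj : j ∈ S) (i : Fin (n+1)) : condProb rho S i j ≤ 1 :=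
  le_of_tendsto' (tendsto_condProb hrho hj i) fun t =>
    le_one_of_mem_rowStochastic (pow_mem (absorb_mem_rowStochastic hrho S) t)

theorem condProb_of_notMem (hrho : rho ∈ rowStochastic ℝ (Fin (n+1))) {i j : Fin (n+1)}
    (hj : j ∈ S) (hi : i ∉ S) :
    condProb rho S i j = ∑ k, rho i k * condProb rho S k j := by
  refine tendsto_nhds_unique ((tendsto_add_atTop_iff_nat 1).2 (tendsto_condProb hrho hj i)) ?_
  have hstep : ∀ t : ℕ, (absorb rho S ^ (t + 1)) i j
      = ∑ k, rho i k * (absorb rho S ^ t) k j := by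
    intro t
    rw [pow_succ', Matrix.mul_apply]
    simp [absorb, hi]
  simp only [hstep]
  exact tendsto_finsetSum _ fun k _ => (tendsto_condProb hrho hj k).const_mul _

theorem condProb_of_mem {i : Fin (n+1)} (hi : i ∈ S) (j : Fin (n+1)) :
    condProb rho S i j = if j = i then 1 else 0 := by
  have hpow : ∀ t : ℕ, (absorb rho S ^ t) i j = if j = i then 1 else 0 := by
    intro t
    induction t with
    | zero => simp [Matrix.one_apply, eq_comm]
    | succ t ih =>
      rw [pow_succ', Matrix.mul_apply]
      simpa [absorb, hi] using ih
  simp only [condProb, hpow]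
  exact tendsto_const_nhds.limUnder_eq

theorem hvecN_le_one (hrho : rho ∈ rowStochastic ℝ (Fin (n+1))) {j : Fin (n+1)}
    (hj : j ∈ S) (x : Fin n) : hvecN rho S j x ≤ 1 :=
  condProb_le_one hrho hj _

theorem hvecN_of_mem {x : Fin n} (hx : x.succ ∈ S) (j : Fin (n+1)) :
    hvecN rho S j x = if j = x.succ then 1 else 0 :=
  condProb_of_mem hx j

/-- `h_{j,S}` is harmonic off `S`. -/
theorem hvecN_of_notMem (hrho : rho ∈ rowStochastic ℝ (Fin (n+1)))
    (hrho0 : ∀ i : Fin (n+1), i ≠ 0 → rho i 0 = 0) {j : Fin (n+1)} {x : Fin n}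
    (hj : j ∈ S) (hx : x.succ ∉ S) :
    hvecN rho S j x = (subRho rho *ᵥ hvecN rho S j) x := by
  rw [hvecN, condProb_of_notMem hrho hj hx, Fin.sum_univ_succ, hrho0 _ (Fin.succ_ne_zero x)]
  simp [mulVec, dotProduct, subRho, hvecN]

theorem subRho_mem_rowStochastic (hrho : rho ∈ rowStochastic ℝ (Fin (n+1)))
    (hrho0 : ∀ i : Fin (n+1), i ≠ 0 → rho i 0 = 0) :
    subRho rho ∈ rowStochastic ℝ (Fin n) := by
  rw [mem_rowStochastic_iff_sum] at hrho ⊢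
  refine ⟨fun i j => hrho.1 _ _, fun i => ?_⟩
  have := hrho.2 i.succ
  rw [Fin.sum_univ_succ, hrho0 _ (Fin.succ_ne_zero i), zero_add] at this
  exact this

end AbsorbingChain

/-- Maximum principle: if a function bounded by `1` is harmonic wherever it equals `1`, then the
set where it equals `1` is closed under accessibility. -/
theorem eq_one_of_pow_apply_pos {ι : Type*} [Fintype ι] [DecidableEq ι] {P : Matrix ι ι ℝ}
    (hP : P ∈ rowStochastic ℝ ι) {f : ι → ℝ} (hf : ∀ x, f x ≤ 1)
    (hharm : ∀ x, f x = 1 → f x = (P *ᵥ f) x) (t : ℕ) {x y : ι} (hx : f x = 1)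
    (hxy : 0 < (P ^ t) x y) : f y = 1 := by
  induction t generalizing x with
  | zero =>
    rcases eq_or_ne x y with rfl | hne
    · exact hx
    · simp [hne] at hxy
  | succ t ih =>
    rw [pow_succ', Matrix.mul_apply] at hxy
    obtain ⟨z, -, hz⟩ := exists_lt_of_sum_lt (s := univ) (f := fun _ : ι => (0 : ℝ))
      (g := fun z => P x z * (P ^ t) z y) (by simpa using hxy)
    have hPz : 0 < P x z := lt_of_le_of_ne (nonneg_of_mem_rowStochastic hP)
      (fun h0 => by simp [← h0] at hz)
    have hsum : ∑ w, P x w * (1 - f w) = 0 := by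
      have := hharm x hx
      simp only [mulVec, dotProduct] at this
      simp only [mul_sub, mul_one, sum_sub_distrib, sum_row_of_mem_rowStochastic hP]
      linarith
    have hterm := (sum_eq_zero_iff_of_nonneg fun w _ =>
      mul_nonneg (nonneg_of_mem_rowStochastic hP) (sub_nonneg.2 (hf w))).1 hsum z (mem_univ z)
    refine ih ?_ (pos_of_mul_pos_right hz hPz.le)
    rcases mul_eq_zero.1 hterm with h0 | h0 <;> linarith

/-- `h_{j,S}` is not harmonic at `j` as soon as `S` contains another product. -/
theorem hvecN_self_sub_ne_zero {n : ℕ} {rho : Matrix (Fin (n+1)) (Fin (n+1)) ℝ}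
    {S : Finset (Fin (n+1))} (hrho : rho ∈ rowStochastic ℝ (Fin (n+1)))
    (hrho0 : ∀ i : Fin (n+1), i ≠ 0 → rho i 0 = 0)
    (hirr : ∀ i j : Fin n, ∃ t : ℕ, 1 ≤ t ∧ 0 < (subRho rho ^ t) i j)
    {x y : Fin n} (hx : x.succ ∈ S) (hy : y.succ ∈ S) (hxy : x ≠ y) :
    hvecN rho S x.succ x - (subRho rho *ᵥ hvecN rho S x.succ) x ≠ 0 := by
  intro h0
  obtain ⟨t, -, ht⟩ := hirr x y
  have h1 : hvecN rho S x.succ y = 1 := by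
    refine eq_one_of_pow_apply_pos (subRho_mem_rowStochastic hrho hrho0)
      (hvecN_le_one hrho hx) (fun z hz => ?_) t (by simp [hvecN_of_mem hx]) ht
    by_cases hzS : z.succ ∈ S
    · rcases eq_or_ne x z with rfl | hne
      · linarith
      · simp [hvecN_of_mem hzS, hne] at hz
    · exact hvecN_of_notMem hrho hrho0 hx hzS
  simp [hvecN_of_mem hy, hxy] at h1

/-- (No "no purchase" option.)  If `S_1, …, S_T ⊆ N` all have cardinality
`r ≥ 2` and a pairwise common intersection `S_∩` of cardinality `r − 1`, then
`dim Span(⋃_{t=1}^T {h_{j,S_t} : j ∈ S_t}) ≥ T + r − 1`. -/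
theorem mccm_dim_common_intersection {n : ℕ} (hn : 2 ≤ n)
    (lam : Fin (n+1) → ℝ) (rho : Matrix (Fin (n+1)) (Fin (n+1)) ℝ)
    (h : IsMCCM lam rho)
    (hlam0 : lam 0 = 0) (hrho0 : ∀ i : Fin (n+1), i ≠ 0 → rho i 0 = 0)
    (r : ℕ) (hr : 2 ≤ r) (T : ℕ) (hT : 1 ≤ T)
    (S : Fin T → Finset (Fin (n+1)))
    (hS0 : ∀ t, (0 : Fin (n+1)) ∉ S t) (hScard : ∀ t, (S t).card = r)
    (Scap : Finset (Fin (n+1)))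
    (hcap : ∀ t t', t ≠ t' → S t ∩ S t' = Scap) (hcapcard : Scap.card = r - 1) :
    Module.finrank ℝ
      ↥(Submodule.span ℝ
        {x : Fin n → ℝ | ∃ t : Fin T, ∃ j ∈ S t, x = hvecN rho (S t) j}) ≥ T + r - 1 := by
  classical
  obtain ⟨-, -, hnonneg, hsum, -, -, hirr⟩ := h
  have hrho : rho ∈ rowStochastic ℝ (Fin (n+1)) :=
    mem_rowStochastic_iff_sum.2 ⟨hnonneg, hsum⟩
  have hex : ∀ t, ∃ x : Fin n, x.succ ∈ S t ∧ x.succ ∉ Scap := by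
    intro t
    obtain ⟨i, hi, hi'⟩ := exists_mem_notMem_of_card_lt_card
      (show Scap.card < (S t).card by rw [hcapcard, hScard]; omega)
    obtain ⟨x, rfl⟩ := Fin.exists_succ_eq.2 (fun h0 : i = 0 => hS0 t (h0 ▸ hi))
    exact ⟨x, hi, hi'⟩
  choose a haS haC using hex
  have haS' : ∀ t t', t ≠ t' → (a t).succ ∉ S t' := fun t t' hne hmem =>
    haC t (hcap t t' hne ▸ mem_inter.2 ⟨haS t, hmem⟩)
  obtain ⟨s, hs⟩ : Scap.Nonempty := card_pos.1 (by omega)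
  let t₀ : Fin T := ⟨0, hT⟩
  let b : {j // j ∈ S t₀} ⊕ {t // t ≠ t₀} → Fin n → ℝ :=
    Sum.elim (fun j => hvecN rho (S t₀) j) (fun t => hvecN rho (S t) (a t).succ)
  have hb : LinearIndependent ℝ b := by
    rw [Fintype.linearIndependent_iff]
    intro g hg
    rw [Fintype.sum_sum_type] at hg
    simp only [b, Sum.elim_inl, Sum.elim_inr] at hg
    let L : (Fin n → ℝ) →ₗ[ℝ] (Fin n → ℝ) := LinearMap.id - (subRho rho).mulVecLin
    have hL : ∀ f x, L f x = f x - (subRho rho *ᵥ f) x := fun f x => rfl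
    have hLzero : ∀ t j x, j ∈ S t → x.succ ∉ S t → L (hvecN rho (S t) j) x = 0 :=
      fun t j x hj hx => by rw [hL, ← hvecN_of_notMem hrho hrho0 hj hx, sub_self]
    have hr' : ∀ t : {t // t ≠ t₀}, g (Sum.inr t) = 0 := by
      intro t
      have hLg := congrFun (congrArg L hg) (a t)
      simp only [map_add, map_sum, map_smul, map_zero, Pi.add_apply, Finset.sum_apply,
        Pi.smul_apply, Pi.zero_apply, smul_eq_mul] at hLg
      rw [sum_eq_zero (fun j _ => by rw [hLzero _ _ _ j.2 (haS' _ _ t.2), mul_zero]),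
        sum_eq_single t (fun t' _ hne => by
          rw [hLzero _ _ _ (haS t') (haS' _ _ fun h => hne (Subtype.ext h.symm)), mul_zero])
          (fun h => absurd (mem_univ t) h), zero_add] at hLg
      refine (mul_eq_zero.1 hLg).resolve_right ?_
      have hsS : s ∈ S t := (mem_inter.1 ((hcap t t₀ t.2).symm ▸ hs)).1
      obtain ⟨y, rfl⟩ := Fin.exists_succ_eq.2 (fun h0 : s = 0 => hS0 t (h0 ▸ hsS))
      exact hvecN_self_sub_ne_zero hrho hrho0 hirr (haS t) hsS
        (fun h => haC t (h ▸ hs))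
    rintro (j | t)
    · obtain ⟨i, hi⟩ := j
      obtain ⟨x, rfl⟩ := Fin.exists_succ_eq.2 (fun h0 : i = 0 => hS0 t₀ (h0 ▸ hi))
      have hx := congrFun hg x
      simp only [hr', zero_smul, sum_const_zero, add_zero, Finset.sum_apply, Pi.smul_apply,
        Pi.zero_apply, smul_eq_mul, hvecN_of_mem hi] at hx
      rw [sum_eq_single ⟨x.succ, hi⟩ (fun j _ hne => by
        rw [if_neg (fun h => hne (Subtype.ext h)), mul_zero])
        (fun h => absurd (mem_univ _) h)] at hx
      simpa using hx
    · exact hr' t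
  have hcard : Fintype.card ({j // j ∈ S t₀} ⊕ {t // t ≠ t₀}) = T + r - 1 := by
    rw [Fintype.card_sum, Fintype.card_coe, hScard, Fintype.card_subtype_compl,
      Fintype.card_subtype_eq, Fintype.card_fin]
    omega
  rw [ge_iff_le, ← hcard, ← finrank_span_eq_card hb]
  refine Submodule.finrank_mono (Submodule.span_mono ?_)
  rintro _ ⟨j | t, rfl⟩
  · exact ⟨t₀, j, j.2, rfl⟩
  · exact ⟨t, _, haS t, rfl⟩
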